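/- arXiv:1607.08908 — 4 statements merged into one kernel-verified Lean document; each statement's English description precedes it below -/
import Mathlib

section
/- Let A be an associative unital algebra over a field k, let L ≥ 4, and let U_1, …, U_{L−1} ∈ A be elements satisfying: U_iU_j = U_jU_i whenever |i−j| ≥ 2; U_iU_{i+1}U_i = U_i and U_{i+1}U_iU_{i+1} = U_{i+1} for all 1 ≤ i ≤ L−2; and U_i² = d_i U_i for scalars d_i ∈ k. Then for every i with 1 ≤ i ≤ L−3, if U_iU_{i+2} ≠ 0 then d_{i+2} = d_i. -/
/-- If `a` and `c` commute, are quasi-idempotent with parameters `d` and `e`, and some `b` satisfies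
`a * b * a = a` and `c * b * c = c`, then `d` and `e` act equally on `a * c`. -/
theorem smul_mul_eq_smul_mul_of_mul_mul_eq_self {k A : Type*} [CommSemiring k] [Semiring A]
    [Algebra k A] {a b c : A} {d e : k} (hac : a * c = c * a) (haba : a * b * a = a)
    (hcbc : c * b * c = c) (ha : a * a = d • a) (hc : c * c = e • c) :
    d • (a * c) = e • (a * c) := by
  calc d • (a * c) = a * a * c := by rw [ha, smul_mul_assoc]
    _ = a * (c * b * c) * a := by rw [hcbc, mul_assoc, mul_assoc, hac]
    _ = (a * c) * b * (c * a) := by simp only [mul_assoc]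
    _ = (c * a) * b * (a * c) := by rw [hac]
    _ = c * (a * b * a) * c := by simp only [mul_assoc]
    _ = a * (c * c) := by rw [haba, ← hac, mul_assoc]
    _ = e • (a * c) := by rw [hc, mul_smul_comm]


/-- In an associative unital algebra `A` over a field `k`, if elements
`U_1, …, U_{L−1}` satisfy the Temperley–Lieb-type relations
(commutation at distance ≥ 2, cubic relations, and `U_i² = d_i U_i`),
then for `1 ≤ i ≤ L−3`, `U_i U_{i+2} ≠ 0` implies `d_{i+2} = d_i`. -/
theorem tl_loop_parameters_homogeneous
    (k : Type*) [Field k] (A : Type*) [Ring A] [Algebra k A]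
    (L : ℕ) (hL : 4 ≤ L) (U : ℕ → A) (d : ℕ → k)
    (hcomm : ∀ i j, 1 ≤ i → 1 ≤ j → i ≤ L - 1 → j ≤ L - 1 →
      (i + 2 ≤ j ∨ j + 2 ≤ i) → U i * U j = U j * U i)
    (hcubic : ∀ i, 1 ≤ i → i ≤ L - 2 →
      U i * U (i + 1) * U i = U i ∧ U (i + 1) * U i * U (i + 1) = U (i + 1))
    (hsq : ∀ i, 1 ≤ i → i ≤ L - 1 → U i * U i = d i • U i) :
    ∀ i, 1 ≤ i → i ≤ L - 3 → U i * U (i + 2) ≠ 0 → d (i + 2) = d i := by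
  intro i hi hiL hne
  exact (smul_left_injective k hne (smul_mul_eq_smul_mul_of_mul_mul_eq_self
    (hcomm i (i + 2) hi (by omega) (by omega) (by omega) (.inl le_rfl))
    (hcubic i hi (by omega)).1 (hcubic (i + 1) (by omega) (by omega)).2
    (hsq i hi (by omega)) (hsq (i + 2) (by omega) (by omega)))).symm
end

section
/- Let K be a field, q ∈ K a nonzero element, δ = q + q⁻¹, and L ≥ 2. With B and E_1, …, E_{L−1} the 2^L × 2^L matrices defined in the context, there exists a K-algebra homomorphism θ : TL_L(δ) → Matrix (2^L) (2^L) K sending the class of the generator U_i to E_i for every 1 ≤ i ≤ L−1. -/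
/-- Defining relations of the Temperley–Lieb algebra `TL_n(δ)` on the free algebra
on generators `U_1, …, U_{n−1}` (indexed by `Fin (n-1)`). -/
inductive TLRel (k : Type*) [Field k] (δ : k) (n : ℕ) :
    FreeAlgebra k (Fin (n - 1)) → FreeAlgebra k (Fin (n - 1)) → Prop
  | square (i : Fin (n - 1)) :
      TLRel k δ n (FreeAlgebra.ι k i * FreeAlgebra.ι k i) (δ • FreeAlgebra.ι k i)
  | cubic (i j : Fin (n - 1)) (h : (i : ℕ) + 1 = j ∨ (j : ℕ) + 1 = i) :
      TLRel k δ n (FreeAlgebra.ι k i * FreeAlgebra.ι k j * FreeAlgebra.ι k i)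
        (FreeAlgebra.ι k i)
  | comm (i j : Fin (n - 1)) (h : (i : ℕ) + 2 ≤ j ∨ (j : ℕ) + 2 ≤ i) :
      TLRel k δ n (FreeAlgebra.ι k i * FreeAlgebra.ι k j)
        (FreeAlgebra.ι k j * FreeAlgebra.ι k i)

/-- The Temperley–Lieb algebra `TL_n(δ)`: the quotient of the free associative unital
`k`-algebra on `U_1, …, U_{n−1}` by the two-sided ideal generated by the relations. -/
abbrev TL (k : Type*) [Field k] (δ : k) (n : ℕ) := RingQuot (TLRel k δ n)

/-- The image of the generator `U_{i+1}` (1-based: the `(i+1)`-st generator) in `TL_n(δ)`. -/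
def TLgen (k : Type*) [Field k] (δ : k) (n : ℕ) (i : Fin (n - 1)) : TL k δ n :=
  RingQuot.mkAlgHom k (TLRel k δ n) (FreeAlgebra.ι k i)


open Kronecker

/-- The local Temperley–Lieb 4×4 matrix `B`. -/
def TLB (K : Type*) [Field K] (q : K) : Matrix (Fin 4) (Fin 4) K :=
  !![0, 0, 0, 0; 0, q⁻¹, -1, 0; 0, -1, q, 0; 0, 0, 0, 0]

/-- Reindexing equivalence identifying the index set of
`I_{2^{i−1}} ⊗ B ⊗ I_{2^{L−i−1}}` with `Fin (2^L)`, for `1 ≤ i ≤ L − 1`. -/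
def kronIndexEquiv (L i : ℕ) (h1 : 1 ≤ i) (h2 : i ≤ L - 1) :
    (Fin (2 ^ (i - 1)) × Fin 4) × Fin (2 ^ (L - i - 1)) ≃ Fin (2 ^ L) :=
  ((finProdFinEquiv.prodCongr (Equiv.refl (Fin (2 ^ (L - i - 1))))).trans
    finProdFinEquiv).trans (finCongr (by
      have hL : 2 ≤ L := by omega
      have : (i - 1) + 2 + (L - i - 1) = L := by omega
      calc 2 ^ (i - 1) * 4 * 2 ^ (L - i - 1)
          = 2 ^ ((i - 1) + 2 + (L - i - 1)) := by rw [pow_add, pow_add]; norm_num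
        _ = 2 ^ L := by rw [this]))

/-- The matrix `E_i = I_{2^{i−1}} ⊗ B ⊗ I_{2^{L−i−1}}` viewed as a `2^L × 2^L` matrix. -/
def TLE (K : Type*) [Field K] (q : K) (L i : ℕ) (h1 : 1 ≤ i) (h2 : i ≤ L - 1) :
    Matrix (Fin (2 ^ L)) (Fin (2 ^ L)) K :=
  Matrix.reindex (kronIndexEquiv L i h1 h2) (kronIndexEquiv L i h1 h2)
    ((1 : Matrix (Fin (2 ^ (i - 1))) (Fin (2 ^ (i - 1))) K) ⊗ₖ TLB K q ⊗ₖ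
      (1 : Matrix (Fin (2 ^ (L - i - 1))) (Fin (2 ^ (L - i - 1))) K))

/-- The matrix `I_a ⊗ M ⊗ I_b`, indexed by `Fin N` where `N = a * d * b`. -/
def kronAmplify {K : Type*} [Field K] {d N : ℕ} (a b : ℕ) (h : a * d * b = N)
    (M : Matrix (Fin d) (Fin d) K) : Matrix (Fin N) (Fin N) K :=
  Matrix.reindex
    (((finProdFinEquiv.prodCongr (Equiv.refl (Fin b))).trans finProdFinEquiv).trans (finCongr h))
    (((finProdFinEquiv.prodCongr (Equiv.refl (Fin b))).trans finProdFinEquiv).trans (finCongr h))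
    ((1 : Matrix (Fin a) (Fin a) K) ⊗ₖ M ⊗ₖ (1 : Matrix (Fin b) (Fin b) K))

section kronAmplify

variable {K : Type*} [Field K] {d N : ℕ}

theorem kronAmplify_mul (a b : ℕ) (h : a * d * b = N) (M M' : Matrix (Fin d) (Fin d) K) :
    kronAmplify a b h (M * M') = kronAmplify a b h M * kronAmplify a b h M' := by
  simp only [kronAmplify, Matrix.reindex_apply, Matrix.submatrix_mul_equiv,
    ← Matrix.mul_kronecker_mul, one_mul]

theorem kronAmplify_smul (a b : ℕ) (h : a * d * b = N) (c : K) (M : Matrix (Fin d) (Fin d) K) :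
    kronAmplify a b h (c • M) = c • kronAmplify a b h M := by
  simp only [kronAmplify, Matrix.kronecker_smul, Matrix.smul_kronecker, Matrix.reindex_apply,
    Matrix.submatrix_smul, Pi.smul_apply]

theorem kronAmplify_apply (a b : ℕ) (h : a * d * b = N) (M : Matrix (Fin d) (Fin d) K)
    (hd : 0 < d) (x y : Fin N) :
    kronAmplify a b h M x y =
      if (x : ℕ) / b / d = y / b / d ∧ (x : ℕ) % b = y % b then
        M ⟨x / b % d, Nat.mod_lt _ hd⟩ ⟨y / b % d, Nat.mod_lt _ hd⟩ else 0 := by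
  subst h
  simp only [kronAmplify, Matrix.reindex_apply, Matrix.submatrix_apply, Matrix.kronecker_apply,
    Matrix.one_apply, Equiv.symm_trans_apply, finCongr_symm, finCongr_apply, Fin.cast_eq_self,
    finProdFinEquiv_symm_apply, Equiv.prodCongr_symm, Equiv.prodCongr_apply, Prod.map,
    Equiv.refl_symm, Equiv.refl_apply, Fin.ext_iff, Fin.coe_divNat, Fin.coe_modNat]
  by_cases h1 : (x : ℕ) / b / d = y / b / d <;> by_cases h2 : (x : ℕ) % b = y % b <;>
    simp [h1, h2, Fin.modNat, Fin.divNat]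

theorem kronAmplify_kronAmplify {D : ℕ} (a b a' b' : ℕ) (h : a * D * b = N)
    (h' : a' * d * b' = D) (h'' : (a * a') * d * (b' * b) = N) (hD : 0 < D)
    (M : Matrix (Fin d) (Fin d) K) :
    kronAmplify a b h (kronAmplify a' b' h' M) = kronAmplify (a * a') (b' * b) h'' M := by
  have hd : 0 < d := by
    rcases Nat.eq_zero_or_pos d with rfl | hd
    · simp at h'; omega
    · exact hd
  have quot_div (x : ℕ) : x % D / b' / d = x / b' / d % a' := by
    rw [← h', Nat.div_div_eq_div_mul, Nat.div_div_eq_div_mul, mul_assoc, mul_comm d b',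
      mul_comm a', Nat.mod_mul_right_div_self]
  have quot_mod (x : ℕ) : x % D / b' % d = x / b' % d := by
    rw [← h', mul_comm (a' * d), Nat.mod_mul_right_div_self,
      Nat.mod_mod_of_dvd _ (Dvd.intro_left _ rfl)]
  have mod_mod (x : ℕ) : x % D % b' = x % b' :=
    Nat.mod_mod_of_dvd _ (h' ▸ Dvd.intro_left _ rfl)
  have quot_quot (x : ℕ) : x / D = x / b' / d / a' := by
    rw [← h', Nat.div_div_eq_div_mul, Nat.div_div_eq_div_mul, mul_comm (a' * d), mul_comm a']
  have mod_iff (x y : ℕ) :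
      x % (b * b') = y % (b * b') ↔ x / b % b' = y / b % b' ∧ x % b = y % b := by
    constructor
    · intro hxy
      rw [← Nat.mod_mul_right_div_self x, ← Nat.mod_mul_right_div_self y, hxy,
        ← Nat.mod_mul_right_mod x b b', hxy, Nat.mod_mul_right_mod]
      exact ⟨rfl, rfl⟩
    · rintro ⟨h1, h2⟩
      rw [Nat.mod_mul, Nat.mod_mul, h1, h2]
  have eq_iff (x y : ℕ) : x = y ↔ x / a' = y / a' ∧ x % a' = y % a' :=
    ⟨fun e => by simp [e], fun ⟨h1, h2⟩ => by
      rw [← Nat.div_add_mod x a', h1, h2, Nat.div_add_mod]⟩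
  ext x y
  simp only [kronAmplify_apply _ _ _ _ hD, kronAmplify_apply _ _ _ _ hd, quot_div, quot_mod,
    mod_mod, quot_quot, mul_comm b' b, mod_iff, ← Nat.div_div_eq_div_mul, ← ite_and]
  have := eq_iff ((x : ℕ) / b / b' / d) (y / b / b' / d)
  congr 1
  simp only [eq_iff_iff]
  tauto

theorem kronAmplify_one_left (a b : ℕ) (h : 1 * a * b = N) (h' : a * b = N) (ha : 0 < a)
    (A : Matrix (Fin a) (Fin a) K) :
    kronAmplify 1 b h A =
      Matrix.reindex (finProdFinEquiv.trans (finCongr h')) (finProdFinEquiv.trans (finCongr h'))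
        (A ⊗ₖ (1 : Matrix (Fin b) (Fin b) K)) := by
  subst h'
  ext x y
  have lt (x : Fin (a * b)) : (x : ℕ) / b < a := Nat.div_lt_of_lt_mul (x.isLt.trans_eq (mul_comm a b))
  rw [kronAmplify_apply _ _ _ _ ha]
  simp [Matrix.one_apply, Fin.ext_iff, Nat.div_eq_of_lt (lt _), Nat.mod_eq_of_lt (lt _),
    Fin.divNat]

theorem kronAmplify_one_right (a b : ℕ) (h : a * b * 1 = N) (h' : a * b = N) (hb : 0 < b)
    (A : Matrix (Fin b) (Fin b) K) :
    kronAmplify a 1 h A =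
      Matrix.reindex (finProdFinEquiv.trans (finCongr h')) (finProdFinEquiv.trans (finCongr h'))
        ((1 : Matrix (Fin a) (Fin a) K) ⊗ₖ A) := by
  subst h'
  ext x y
  rw [kronAmplify_apply _ _ _ _ hb]
  simp [Matrix.one_apply, Fin.ext_iff, Fin.modNat, Nat.mod_one]

theorem commute_kronAmplify (a b : ℕ) (h : 1 * a * b = N) (h' : a * b * 1 = N) (ha : 0 < a)
    (hb : 0 < b) (A : Matrix (Fin a) (Fin a) K) (C : Matrix (Fin b) (Fin b) K) :
    Commute (kronAmplify 1 b h A) (kronAmplify a 1 h' C) := by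
  have hN : a * b = N := by simpa using h'
  rw [kronAmplify_one_left a b h hN ha, kronAmplify_one_right a b h' hN hb, commute_iff_eq]
  simp only [Matrix.reindex_apply, Matrix.submatrix_mul_equiv, ← Matrix.mul_kronecker_mul,
    one_mul, mul_one]

end kronAmplify

section TLB

variable {K : Type*} [Field K]

theorem TLB_mul_self {q : K} (hq : q ≠ 0) : TLB K q * TLB K q = (q + q⁻¹) • TLB K q := by
  ext i j
  fin_cases i <;> fin_cases j <;> simp [TLB, Matrix.mul_apply, Fin.sum_univ_four] <;>
    field_simp <;> ring

theorem kronAmplify_one_two_TLB (q : K) :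
    kronAmplify (N := 8) 1 2 rfl (TLB K q) =
      !![0, 0, 0, 0, 0, 0, 0, 0; 0, 0, 0, 0, 0, 0, 0, 0; 0, 0, q⁻¹, 0, -1, 0, 0, 0;
        0, 0, 0, q⁻¹, 0, -1, 0, 0; 0, 0, -1, 0, q, 0, 0, 0; 0, 0, 0, -1, 0, q, 0, 0;
        0, 0, 0, 0, 0, 0, 0, 0; 0, 0, 0, 0, 0, 0, 0, 0] := by
  ext i j
  rw [kronAmplify_apply _ _ _ _ (by decide)]
  fin_cases i <;> fin_cases j <;> rfl

theorem kronAmplify_two_one_TLB (q : K) :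
    kronAmplify (N := 8) 2 1 rfl (TLB K q) =
      !![0, 0, 0, 0, 0, 0, 0, 0; 0, q⁻¹, -1, 0, 0, 0, 0, 0; 0, -1, q, 0, 0, 0, 0, 0;
        0, 0, 0, 0, 0, 0, 0, 0; 0, 0, 0, 0, 0, 0, 0, 0; 0, 0, 0, 0, 0, q⁻¹, -1, 0;
        0, 0, 0, 0, 0, -1, q, 0; 0, 0, 0, 0, 0, 0, 0, 0] := by
  ext i j
  rw [kronAmplify_apply _ _ _ _ (by decide)]
  fin_cases i <;> fin_cases j <;> rfl

theorem kronAmplify_TLB_left_right_left {q : K} (hq : q ≠ 0) :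
    kronAmplify (N := 8) 1 2 rfl (TLB K q) * kronAmplify 2 1 rfl (TLB K q) *
      kronAmplify 1 2 rfl (TLB K q) = kronAmplify 1 2 rfl (TLB K q) := by
  simp [kronAmplify_one_two_TLB, kronAmplify_two_one_TLB, hq]
  ext k
  fin_cases k <;> rfl

theorem kronAmplify_TLB_right_left_right {q : K} (hq : q ≠ 0) :
    kronAmplify (N := 8) 2 1 rfl (TLB K q) * kronAmplify 1 2 rfl (TLB K q) *
      kronAmplify 2 1 rfl (TLB K q) = kronAmplify 2 1 rfl (TLB K q) := by
  simp [kronAmplify_one_two_TLB, kronAmplify_two_one_TLB, hq]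
  ext k
  fin_cases k <;> rfl

end TLB

section TLE

variable {K : Type*} [Field K] (q : K) {L : ℕ}

theorem two_pow_mul_mul {a c e : ℕ} (h : a + c + e = L) : 2 ^ a * 2 ^ c * 2 ^ e = 2 ^ L := by
  rw [← pow_add, ← pow_add, h]

theorem two_pow_mul_four_mul {a e : ℕ} (h : a + 2 + e = L) : 2 ^ a * 4 * 2 ^ e = 2 ^ L :=
  two_pow_mul_mul (c := 2) h

theorem TLE_eq_kronAmplify {i a e : ℕ} (h1 : 1 ≤ i) (h2 : i ≤ L - 1) (ha : a + 1 = i)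
    (he : a + 2 + e = L) :
    TLE K q L i h1 h2 = kronAmplify (2 ^ a) (2 ^ e) (two_pow_mul_four_mul he) (TLB K q) := by
  subst ha
  obtain rfl : e = L - (a + 1) - 1 := by omega
  rfl

theorem TLE_eq_kronAmplify_kronAmplify {i a c e a' e' : ℕ} (h1 : 1 ≤ i) (h2 : i ≤ L - 1)
    (h : a + c + e = L) (h' : a' + 2 + e' = c) (hi : a + a' + 1 = i) :
    TLE K q L i h1 h2 = kronAmplify (2 ^ a) (2 ^ e) (two_pow_mul_mul h)
      (kronAmplify (2 ^ a') (2 ^ e') (two_pow_mul_four_mul h') (TLB K q)) := by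
  rw [kronAmplify_kronAmplify (h'' := by
    rw [← pow_add, ← pow_add]; exact two_pow_mul_four_mul (by omega)) (hD := by positivity)]
  rw [TLE_eq_kronAmplify q h1 h2 hi (e := e' + e) (by omega)]
  congr 1 <;> exact pow_add _ _ _

theorem TLE_mul_self {q : K} (hq : q ≠ 0) {i : ℕ} (h1 : 1 ≤ i) (h2 : i ≤ L - 1) :
    TLE K q L i h1 h2 * TLE K q L i h1 h2 = (q + q⁻¹) • TLE K q L i h1 h2 := by
  rw [TLE_eq_kronAmplify q h1 h2 (a := i - 1) (e := L - i - 1) (by omega) (by omega),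
    ← kronAmplify_mul, TLB_mul_self hq, kronAmplify_smul]

theorem TLE_mul_mul_succ {q : K} (hq : q ≠ 0) {i : ℕ} (h1 : 1 ≤ i) (h2 : i + 1 ≤ L - 1) :
    TLE K q L i h1 (by omega) * TLE K q L (i + 1) (by omega) h2 * TLE K q L i h1 (by omega) =
      TLE K q L i h1 (by omega) := by
  rw [TLE_eq_kronAmplify_kronAmplify q h1 (by omega) (a := i - 1) (c := 3) (e := L - i - 2)
      (a' := 0) (e' := 1) (by omega) rfl (by omega),
    TLE_eq_kronAmplify_kronAmplify q (by omega) h2 (a := i - 1) (c := 3) (e := L - i - 2)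
      (a' := 1) (e' := 0) (by omega) rfl (by omega), ← kronAmplify_mul, ← kronAmplify_mul]
  exact congrArg _ (kronAmplify_TLB_left_right_left hq)

theorem TLE_succ_mul_mul {q : K} (hq : q ≠ 0) {i : ℕ} (h1 : 1 ≤ i) (h2 : i + 1 ≤ L - 1) :
    TLE K q L (i + 1) (by omega) h2 * TLE K q L i h1 (by omega) *
      TLE K q L (i + 1) (by omega) h2 = TLE K q L (i + 1) (by omega) h2 := by
  rw [TLE_eq_kronAmplify_kronAmplify q h1 (by omega) (a := i - 1) (c := 3) (e := L - i - 2)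
      (a' := 0) (e' := 1) (by omega) rfl (by omega),
    TLE_eq_kronAmplify_kronAmplify q (by omega) h2 (a := i - 1) (c := 3) (e := L - i - 2)
      (a' := 1) (e' := 0) (by omega) rfl (by omega), ← kronAmplify_mul, ← kronAmplify_mul]
  exact congrArg _ (kronAmplify_TLB_right_left_right hq)

theorem commute_TLE {i j : ℕ} (h1 : 1 ≤ i) (hij : i + 2 ≤ j) (h2 : j ≤ L - 1) :
    Commute (TLE K q L i h1 (by omega)) (TLE K q L j (by omega) h2) := by
  rw [TLE_eq_kronAmplify_kronAmplify q h1 (by omega) (a := 0) (c := i + 1) (e := L - i - 1)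
      (a' := i - 1) (e' := 0) (by omega) (by omega) (by omega),
    TLE_eq_kronAmplify_kronAmplify q (by omega) h2 (a := i + 1) (c := L - i - 1) (e := 0)
      (a' := j - i - 2) (e' := L - j - 1) (by omega) (by omega) (by omega)]
  exact commute_kronAmplify _ _ _ _ (by positivity) (by positivity) _ _

end TLE

/-- there is a `K`-algebra homomorphism `θ : TL_L(δ) → Mat_{2^L}(K)`,
`δ = q + q⁻¹`, sending the class of the generator `U_{i+1}` to
`E_{i+1} = I_{2^i} ⊗ B ⊗ I_{2^{L−i−2}}`. -/
theorem tl_tensor_space_representation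
    (K : Type*) [Field K] (q : K) (hq : q ≠ 0) (L : ℕ) (hL : 2 ≤ L) :
    ∃ θ : TL K (q + q⁻¹) L →ₐ[K] Matrix (Fin (2 ^ L)) (Fin (2 ^ L)) K,
      ∀ i : Fin (L - 1),
        θ (TLgen K (q + q⁻¹) L i) =
          TLE K q L ((i : ℕ) + 1) (Nat.succ_le_succ (Nat.zero_le _)) i.isLt := by
  let E (i : Fin (L - 1)) : Matrix (Fin (2 ^ L)) (Fin (2 ^ L)) K :=
    TLE K q L ((i : ℕ) + 1) (Nat.succ_le_succ (Nat.zero_le _)) i.isLt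
  have rel : ∀ ⦃x y⦄, TLRel K (q + q⁻¹) L x y →
      FreeAlgebra.lift K E x = FreeAlgebra.lift K E y := by
    intro x y hxy
    induction hxy with
    | square i =>
      simpa using TLE_mul_self hq (Nat.succ_le_succ (Nat.zero_le _)) i.isLt
    | cubic i j h =>
      obtain ⟨i, hi⟩ := i
      obtain ⟨j, hj⟩ := j
      simp only [map_mul, FreeAlgebra.lift_ι_apply]
      rcases h with h | h <;> dsimp only at h <;> subst h
      · exact TLE_mul_mul_succ hq _ hj
      · exact TLE_succ_mul_mul hq _ hi
    | comm i j h =>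
      simp only [map_mul, FreeAlgebra.lift_ι_apply]
      rcases h with h | h
      · exact commute_TLE q _ (by omega) _
      · exact (commute_TLE q _ (by omega) _).symm
  refine ⟨RingQuot.liftAlgHom K ⟨FreeAlgebra.lift K E, rel⟩, fun i => ?_⟩
  rw [TLgen, RingQuot.liftAlgHom_mkAlgHom_apply, FreeAlgebra.lift_ι_apply]
end

section
/- Let k be a field, δ ∈ k, and n ≥ 2. Define scalars Δ_0 = 1, Δ_1 = δ, and Δ_{m+1} = δ·Δ_m − Δ_{m−1} for m ≥ 1. If Δ_m ≠ 0 for all 1 ≤ m ≤ n−1, then there exists a unique nonzero idempotent E ∈ TL_n(δ) (E² = E, E ≠ 0) such that E·U_i = 0 and U_i·E = 0 for all generators U_i, 1 ≤ i ≤ n−1. -/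
/-- The Chebyshev-type sequence `Δ_0 = 1`, `Δ_1 = δ`, `Δ_{m+1} = δ·Δ_m − Δ_{m−1}`. -/
def chebDelta (k : Type*) [Field k] (δ : k) : ℕ → k
  | 0 => 1
  | 1 => δ
  | (m + 2) => δ * chebDelta k δ (m + 1) - chebDelta k δ m

section JonesWenzl

variable {k A : Type*} [Field k] [Ring A] [Algebra k A]

/-- Wenzl's recursion: `jonesWenzl δ U m` is the Jones–Wenzl projection built from
`U 0, …, U (m - 1)`. -/
noncomputable def jonesWenzl (δ : k) (U : ℕ → A) : ℕ → A
  | 0 => 1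
  | m + 1 => jonesWenzl δ U m -
      (chebDelta k δ m / chebDelta k δ (m + 1)) • (jonesWenzl δ U m * U m * jonesWenzl δ U m)

/-- `U 0, …, U (N - 1)` satisfy the Temperley–Lieb relations with parameter `δ`. -/
structure IsTLFamily (δ : k) (U : ℕ → A) (N : ℕ) : Prop where
  square : ∀ i < N, U i * U i = δ • U i
  cubic : ∀ i, i + 1 < N → U (i + 1) * U i * U (i + 1) = U (i + 1)
  comm : ∀ i j, i + 2 ≤ j → j < N → Commute (U j) (U i)

/-- The properties of the Jones–Wenzl projections carried along Wenzl's recursion. -/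
structure IsWenzlStage (δ : k) (U : ℕ → A) (N m : ℕ) : Prop where
  idem : jonesWenzl δ U m * jonesWenzl δ U m = jonesWenzl δ U m
  gen_mul : ∀ i < m, U i * jonesWenzl δ U m = 0
  mul_gen : ∀ i < m, jonesWenzl δ U m * U i = 0
  comm : ∀ j, m + 1 ≤ j → j < N → Commute (U j) (jonesWenzl δ U m)
  comm_pred : m < N → Commute (U m) (jonesWenzl δ U (m - 1))
  pred_mul : jonesWenzl δ U (m - 1) * jonesWenzl δ U m = jonesWenzl δ U m
  mul_pred : jonesWenzl δ U m * jonesWenzl δ U (m - 1) = jonesWenzl δ U m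
  partial_trace : m < N → U m * jonesWenzl δ U m * U m =
    (chebDelta k δ (m + 1) / chebDelta k δ m) • (jonesWenzl δ U (m - 1) * U m)

theorem IsTLFamily.isWenzlStage_zero {δ : k} {U : ℕ → A} {N : ℕ} (hU : IsTLFamily δ U N) :
    IsWenzlStage δ U N 0 where
  idem := by simp [jonesWenzl]
  gen_mul := by simp
  mul_gen := by simp
  comm := by simp [jonesWenzl]
  comm_pred := by simp [jonesWenzl]
  pred_mul := by simp [jonesWenzl]
  mul_pred := by simp [jonesWenzl]
  partial_trace h := by simp [jonesWenzl, chebDelta, hU.square 0 h]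

theorem IsTLFamily.isWenzlStage_succ {δ : k} {U : ℕ → A} {N m : ℕ} (hU : IsTLFamily δ U N)
    (hm : m < N) (h₀ : chebDelta k δ m ≠ 0) (h₁ : chebDelta k δ (m + 1) ≠ 0)
    (h : IsWenzlStage δ U N m) : IsWenzlStage δ U N (m + 1) := by
  obtain ⟨idem, gen_mul, mul_gen, comm, comm_pred, pred_mul, mul_pred, ptrace⟩ := h
  have comm_pred := (comm_pred hm).eq
  have ptrace := ptrace hm
  set P := jonesWenzl δ U m
  set Q := jonesWenzl δ U (m - 1)
  set c := chebDelta k δ m / chebDelta k δ (m + 1) with hc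
  have hcd : c * (chebDelta k δ (m + 1) / chebDelta k δ m) = 1 := by
    rw [hc]; field_simp
  have hS : jonesWenzl δ U (m + 1) = P - c • (P * U m * P) := rfl
  have ptrace' : c • (U m * P * U m) = Q * U m := by
    rw [ptrace, smul_smul, hcd, one_smul]
  have left_zero : U m * jonesWenzl δ U (m + 1) = 0 := by
    have : U m * jonesWenzl δ U (m + 1) = U m * P - c • (U m * P * U m) * P := by
      rw [hS]; simp only [mul_sub, mul_smul_comm, smul_mul_assoc, mul_assoc]
    rw [this, ptrace', ← comm_pred, mul_assoc, pred_mul, sub_self]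
  have right_zero : jonesWenzl δ U (m + 1) * U m = 0 := by
    have : jonesWenzl δ U (m + 1) * U m = P * U m - P * (c • (U m * P * U m)) := by
      rw [hS]; simp only [sub_mul, mul_smul_comm, smul_mul_assoc, mul_assoc]
    rw [this, ptrace', ← mul_assoc, mul_pred, sub_self]
  have pred_mul' : P * jonesWenzl δ U (m + 1) = jonesWenzl δ U (m + 1) := by
    rw [hS, mul_sub, mul_smul_comm, ← mul_assoc, ← mul_assoc, idem]
  have mul_pred' : jonesWenzl δ U (m + 1) * P = jonesWenzl δ U (m + 1) := by
    rw [hS, sub_mul, smul_mul_assoc, mul_assoc _ P P, idem]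
  refine ⟨?_, ?_, ?_, ?_, ?_, pred_mul', mul_pred', ?_⟩
  · calc jonesWenzl δ U (m + 1) * jonesWenzl δ U (m + 1)
        = (P - c • (P * U m * P)) * jonesWenzl δ U (m + 1) := by rw [← hS]
      _ = jonesWenzl δ U (m + 1) := by
          rw [sub_mul, smul_mul_assoc, mul_assoc, pred_mul', mul_assoc, left_zero, mul_zero,
            smul_zero, sub_zero]
  · intro i hi
    rcases Nat.lt_succ_iff_lt_or_eq.1 hi with hi | rfl
    · rw [← pred_mul', ← mul_assoc, gen_mul i hi, zero_mul]
    · exact left_zero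
  · intro i hi
    rcases Nat.lt_succ_iff_lt_or_eq.1 hi with hi | rfl
    · rw [← mul_pred', mul_assoc, mul_gen i hi, mul_zero]
    · exact right_zero
  · intro j hj hjN
    have hjP := comm j (by omega) hjN
    rw [hS]
    exact hjP.sub_right (((hjP.mul_right (hU.comm m j hj hjN)).mul_right hjP).smul_right c)
  · exact fun hN => comm (m + 1) le_rfl hN
  · intro hN
    have hV := (comm (m + 1) le_rfl hN).eq
    have expand : U (m + 1) * (P * U m * P) * U (m + 1) = P * U (m + 1) := by
      calc U (m + 1) * (P * U m * P) * U (m + 1)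
          = (U (m + 1) * P) * U m * (P * U (m + 1)) := by simp only [mul_assoc]
        _ = P * (U (m + 1) * U m * U (m + 1)) * P := by
            rw [hV]
            simp only [mul_assoc, hV]
        _ = P * U (m + 1) := by
            rw [hU.cubic m hN, mul_assoc, hV, ← mul_assoc, idem]
    have hΔ : chebDelta k δ (m + 1 + 1) / chebDelta k δ (m + 1) = δ - c := by
      rw [hc, chebDelta]; field_simp
    rw [hΔ, hS, mul_sub, sub_mul, mul_smul_comm, smul_mul_assoc, expand, hV, mul_assoc,
      hU.square _ hN, mul_smul_comm, sub_smul, Nat.add_sub_cancel]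

theorem IsTLFamily.isWenzlStage {δ : k} {U : ℕ → A} {N : ℕ} (hU : IsTLFamily δ U N)
    (hΔ : ∀ m ≤ N, chebDelta k δ m ≠ 0) : ∀ m ≤ N, IsWenzlStage δ U N m
  | 0, _ => hU.isWenzlStage_zero
  | m + 1, hm => hU.isWenzlStage_succ hm (hΔ m (by omega)) (hΔ (m + 1) hm)
      (hU.isWenzlStage hΔ m (by omega))

theorem map_jonesWenzl {δ : k} {U : ℕ → A} (ε : A →ₐ[k] k) (hε : ∀ i, ε (U i) = 0) (m : ℕ) :
    ε (jonesWenzl δ U m) = 1 := by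
  induction m with
  | zero => simp [jonesWenzl]
  | succ m ih => simp [jonesWenzl, ih, hε]

end JonesWenzl

section TemperleyLieb

variable (k : Type*) [Field k] (δ : k) (n : ℕ)

/-- The augmentation of `TL_n(δ)`, sending every generator to zero. -/
noncomputable def TLaug : TL k δ n →ₐ[k] k :=
  RingQuot.liftAlgHom k ⟨FreeAlgebra.lift k (fun _ => (0 : k)), by
    intro x y h
    cases h <;> simp⟩

theorem TLaug_gen (i : Fin (n - 1)) : TLaug k δ n (TLgen k δ n i) = 0 := by
  simp [TLaug, TLgen]

/-- The generators of `TL_n(δ)` as a sequence, extended by zero. -/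
noncomputable def TLseq (i : ℕ) : TL k δ n :=
  if h : i < n - 1 then TLgen k δ n ⟨i, h⟩ else 0

theorem TLseq_coe (i : Fin (n - 1)) : TLseq k δ n i = TLgen k δ n i := by
  simp [TLseq]

theorem TLaug_seq (i : ℕ) : TLaug k δ n (TLseq k δ n i) = 0 := by
  unfold TLseq
  split_ifs
  · exact TLaug_gen k δ n _
  · exact map_zero _

theorem isTLFamily_TLseq : IsTLFamily δ (TLseq k δ n) (n - 1) where
  square i hi := by
    simpa [TLseq, hi, TLgen] using RingQuot.mkAlgHom_rel k (TLRel.square (δ := δ) (n := n) ⟨i, hi⟩)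
  cubic i hi := by
    have hi' : i < n - 1 := by omega
    simpa [TLseq, hi, hi', TLgen] using RingQuot.mkAlgHom_rel k
      (TLRel.cubic (δ := δ) (n := n) ⟨i + 1, hi⟩ ⟨i, hi'⟩ (Or.inr rfl))
  comm i j hij hj := by
    have hi : i < n - 1 := by omega
    simpa [TLseq, hi, hj, TLgen, Commute, SemiconjBy] using RingQuot.mkAlgHom_rel k
      (TLRel.comm (δ := δ) (n := n) ⟨j, hj⟩ ⟨i, hi⟩ (Or.inr hij))

variable {k δ n}

theorem TL_induction {p : TL k δ n → Prop} (hscalar : ∀ r, p (algebraMap k _ r))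
    (hgen : ∀ i, p (TLgen k δ n i)) (hmul : ∀ x y, p x → p y → p (x * y))
    (hadd : ∀ x y, p x → p y → p (x + y)) (x : TL k δ n) : p x := by
  obtain ⟨a, rfl⟩ := RingQuot.mkAlgHom_surjective k (TLRel k δ n) x
  induction a using FreeAlgebra.induction with
  | grade0 r => rw [AlgHom.commutes]; exact hscalar r
  | grade1 i => exact hgen i
  | mul a b ha hb => rw [map_mul]; exact hmul _ _ ha hb
  | add a b ha hb => rw [map_add]; exact hadd _ _ ha hb

theorem mul_eq_TLaug_smul {E : TL k δ n} (hE : ∀ i, E * TLgen k δ n i = 0) (x : TL k δ n) :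
    E * x = TLaug k δ n x • E := by
  induction x using TL_induction with
  | hscalar r => rw [AlgHom.commutes, ← Algebra.commutes, Algebra.smul_def]; rfl
  | hgen i => rw [hE, TLaug_gen, zero_smul]
  | hmul x y hx hy => rw [← mul_assoc, hx, smul_mul_assoc, hy, smul_smul, map_mul]
  | hadd x y hx hy => rw [mul_add, hx, hy, map_add, add_smul]

theorem mul_eq_TLaug_smul' {E : TL k δ n} (hE : ∀ i, TLgen k δ n i * E = 0) (x : TL k δ n) :
    x * E = TLaug k δ n x • E := by
  induction x using TL_induction with
  | hscalar r => rw [AlgHom.commutes, Algebra.smul_def]; rfl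
  | hgen i => rw [hE, TLaug_gen, zero_smul]
  | hmul x y hx hy => rw [mul_assoc, hy, mul_smul_comm, hx, smul_smul, map_mul, mul_comm]
  | hadd x y hx hy => rw [add_mul, hx, hy, map_add, add_smul]

theorem TLaug_eq_one {E : TL k δ n} (hidem : E * E = E) (hne : E ≠ 0)
    (hE : ∀ i, E * TLgen k δ n i = 0) : TLaug k δ n E = 1 := by
  have h := mul_eq_TLaug_smul hE E
  rw [hidem] at h
  exact smul_left_injective k hne (by simpa using h.symm)

end TemperleyLieb

/-- if `Δ_m ≠ 0` for `1 ≤ m ≤ n−1`, then `TL_n(δ)` contains a unique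
nonzero idempotent `E` (the Jones–Wenzl projection) annihilating all generators. -/
theorem jones_wenzl_exists_unique
    (k : Type*) [Field k] (δ : k) (n : ℕ) (hn : 2 ≤ n)
    (hΔ : ∀ m, 1 ≤ m → m ≤ n - 1 → chebDelta k δ m ≠ 0) :
    ∃! E : TL k δ n, (E * E = E ∧ E ≠ 0) ∧
      ∀ i : Fin (n - 1), E * TLgen k δ n i = 0 ∧ TLgen k δ n i * E = 0 := by
  have hΔ' : ∀ m ≤ n - 1, chebDelta k δ m ≠ 0 := by
    intro m hm
    rcases Nat.eq_zero_or_pos m with rfl | hpos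
    · simp [chebDelta]
    · exact hΔ m hpos hm
  have hstage := (isTLFamily_TLseq k δ n).isWenzlStage hΔ' (n - 1) le_rfl
  refine existsUnique_of_exists_of_unique
    ⟨jonesWenzl δ (TLseq k δ n) (n - 1), ⟨hstage.idem, fun h0 => ?_⟩, fun i => ?_⟩ ?_
  · have h1 := map_jonesWenzl (δ := δ) (TLaug k δ n) (TLaug_seq k δ n) (n - 1)
    rw [h0, map_zero] at h1
    exact zero_ne_one h1
  · rw [← TLseq_coe]
    exact ⟨hstage.mul_gen i i.2, hstage.gen_mul i i.2⟩
  · rintro E F ⟨⟨hE, hE0⟩, hEU⟩ ⟨⟨hF, hF0⟩, hFU⟩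
    have h1 := mul_eq_TLaug_smul (fun i => (hEU i).1) F
    have h2 := mul_eq_TLaug_smul' (fun i => (hFU i).2) E
    rw [TLaug_eq_one hF hF0 fun i => (hFU i).1, one_smul] at h1
    rw [TLaug_eq_one hE hE0 fun i => (hEU i).1, one_smul] at h2
    exact h1.symm.trans h2
end

section
/- Let k be a field, δ ∈ k, and n ≥ 2. If E and F are nonzero idempotents of TL_n(δ) (E² = E ≠ 0 and F² = F ≠ 0) satisfying E·U_i = 0, U_i·E = 0, F·U_i = 0, and U_i·F = 0 for all generators U_i, 1 ≤ i ≤ n−1, then E = F. -/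
/-- Every element of `TL_n(δ)` acts by one and the same scalar on all elements that the generators
annihilate from the left, and on all those that they annihilate from the right. -/
theorem TL.exists_smul_of_gen_annihilates (k : Type*) [Field k] (δ : k) (n : ℕ) (a : TL k δ n) :
    ∃ c : k, ∀ X : TL k δ n,
      ((∀ i, TLgen k δ n i * X = 0) → a * X = c • X) ∧
      ((∀ i, X * TLgen k δ n i = 0) → X * a = c • X) := by
  obtain ⟨b, rfl⟩ := RingQuot.mkAlgHom_surjective k (TLRel k δ n) a
  induction b using FreeAlgebra.induction with
  | grade0 r =>
    refine ⟨r, fun X => ⟨fun _ => ?_, fun _ => ?_⟩⟩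
    · rw [AlgHom.commutes, Algebra.smul_def]
    · rw [AlgHom.commutes, Algebra.smul_def, Algebra.commutes]
  | grade1 i =>
    refine ⟨0, fun X => ⟨fun h => ?_, fun h => ?_⟩⟩
    · rw [zero_smul]; exact h i
    · rw [zero_smul]; exact h i
  | mul a b ha hb =>
    obtain ⟨c, hc⟩ := ha
    obtain ⟨d, hd⟩ := hb
    refine ⟨c * d, fun X => ⟨fun h => ?_, fun h => ?_⟩⟩
    · rw [map_mul, mul_assoc, (hd X).1 h, mul_smul_comm, (hc X).1 h, smul_smul, mul_comm]
    · rw [map_mul, ← mul_assoc, (hc X).2 h, smul_mul_assoc, (hd X).2 h, smul_smul]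
  | add a b ha hb =>
    obtain ⟨c, hc⟩ := ha
    obtain ⟨d, hd⟩ := hb
    refine ⟨c + d, fun X => ⟨fun h => ?_, fun h => ?_⟩⟩
    · rw [map_add, add_mul, (hc X).1 h, (hd X).1 h, add_smul]
    · rw [map_add, mul_add, (hc X).2 h, (hd X).2 h, add_smul]

/-- two nonzero idempotents of `TL_n(δ)` that annihilate all the
generators `U_i` on both sides must be equal. -/
theorem jones_wenzl_unique
    (k : Type*) [Field k] (δ : k) (n : ℕ) (hn : 2 ≤ n)
    (E F : TL k δ n)
    (hE : E * E = E) (hE0 : E ≠ 0)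
    (hF : F * F = F) (hF0 : F ≠ 0)
    (hEU : ∀ i : Fin (n - 1), E * TLgen k δ n i = 0 ∧ TLgen k δ n i * E = 0)
    (hFU : ∀ i : Fin (n - 1), F * TLgen k δ n i = 0 ∧ TLgen k δ n i * F = 0) :
    E = F := by
  obtain ⟨c, hc⟩ := TL.exists_smul_of_gen_annihilates k δ n E
  obtain ⟨d, hd⟩ := TL.exists_smul_of_gen_annihilates k δ n F
  have hc1 : c = 1 := by
    have h := (hc E).1 fun i => (hEU i).2
    rw [hE] at h
    exact smul_left_injective k hE0 (by simpa using h.symm)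
  have hd1 : d = 1 := by
    have h := (hd F).1 fun i => (hFU i).2
    rw [hF] at h
    exact smul_left_injective k hF0 (by simpa using h.symm)
  have h1 : E * F = F := by simpa [hc1] using (hc F).1 fun i => (hFU i).2
  have h2 : E * F = E := by simpa [hd1] using (hd E).2 fun i => (hEU i).1
  exact h2.symm.trans h1
end
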